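/- Let r ≥ 1 and let B_1, …, B_r be disjoint copies of the closed unit disc D² ⊂ ℝ², each with the two marked points p_+ = (0,1) and p_- = (0,−1) and the two boundary arcs E_s^{left} and E_s^{right} (the closures of the left and right halves of the unit circle), each arc regarded as an edge with endpoints p_+ and p_-. Suppose given a partition of the set of all 2r edges into pairs, and for each pair a homeomorphism between the two arcs carrying the set {p_+, p_-} onto the set {p_+, p_-}; let Y be the quotient of the disjoint union of the B_s by these identifications, with the quotient topology, and suppose Y is connected. Then: if for every s the images in Y of the two points p_+ and p_- of B_s are distinct, Y is homeomorphic to the 2-sphere S² (the unit sphere in ℝ³); otherwise Y is homeomorphic to the real projective plane, defined as the quotient of S² by the identifications x ∼ −x. -/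

import Mathlib

open scoped Classical

noncomputable section

/-- The closed unit disc `D² ⊂ ℝ²`. -/
def Disc : Set (EuclideanSpace ℝ (Fin 2)) := Metric.closedBall 0 1

/-- The marked point `p₊ = (0,1)` of the disc. -/
def pP : EuclideanSpace ℝ (Fin 2) := EuclideanSpace.single 1 (1 : ℝ)

/-- The marked point `p₋ = (0,-1)` of the disc. -/
def pM : EuclideanSpace ℝ (Fin 2) := EuclideanSpace.single 1 (-1 : ℝ)

theorem pP_mem : pP ∈ Disc := by
  simp [Disc, pP, Metric.mem_closedBall, dist_eq_norm, EuclideanSpace.norm_single]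

theorem pM_mem : pM ∈ Disc := by
  simp [Disc, pM, Metric.mem_closedBall, dist_eq_norm, EuclideanSpace.norm_single]

/-- The disjoint union of `r` copies `B₁, …, B_r` of the closed unit disc. -/
abbrev DiscUnion (r : ℕ) : Type := Σ _ : Fin r, ↥Disc

/-- The boundary arc of the copy `B_s` indexed by the edge `e = (s, side)`: the closure
of the right (`side = true`) or left (`side = false`) half of the unit circle, an edge
with endpoints `p₊` and `p₋`. -/
def arc {r : ℕ} (e : Fin r × Bool) : Set (DiscUnion r) :=
  {p | p.1 = e.1 ∧ (p.2 : EuclideanSpace ℝ (Fin 2)) ∈ Metric.sphere (0 : EuclideanSpace ℝ (Fin 2)) 1 ∧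
    (if e.2 then 0 ≤ (p.2 : EuclideanSpace ℝ (Fin 2)) 0
      else (p.2 : EuclideanSpace ℝ (Fin 2)) 0 ≤ 0)}

/-- The glueing relation determined by the arc identifications `h`. -/
def bigonRel {r : ℕ} (π : Fin r × Bool → Fin r × Bool)
    (h : ∀ e, ↥(arc (r := r) e) ≃ₜ ↥(arc (π e))) :
    DiscUnion r → DiscUnion r → Prop := fun p q =>
  ∃ (e : Fin r × Bool) (hp : p ∈ arc e), ((h e ⟨p, hp⟩ : ↥(arc (π e))) : DiscUnion r) = q

/-- The real projective plane: the quotient of `S²` by the antipodal identifications. -/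
abbrev ProjPlane : Type :=
  Quot (fun x y : ↥(Metric.sphere (0 : EuclideanSpace ℝ (Fin 3)) 1) =>
    (y : EuclideanSpace ℝ (Fin 3)) = -(x : EuclideanSpace ℝ (Fin 3)))


abbrev II : Type := ↥(Set.Icc (0:ℝ) 1)
abbrev JJ : Type := ↥(Set.Icc (-1:ℝ) 1)

def i0 : II := ⟨0, by norm_num⟩
def i1 : II := ⟨1, by norm_num⟩
def jP : JJ := ⟨1, by norm_num⟩
def jM : JJ := ⟨-1, by norm_num⟩

def eps (b : Bool) : ℝ := if b then 1 else -1

theorem eps_sq (b : Bool) : eps b * eps b = 1 := by cases b <;> simp [eps]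
theorem eps_not (b : Bool) : eps (!b) = - eps b := by cases b <;> simp [eps]

theorem mem_Disc_iff (x : EuclideanSpace ℝ (Fin 2)) : x ∈ Disc ↔ x 0 ^ 2 + x 1 ^ 2 ≤ 1 := by
  rw [Disc, Metric.mem_closedBall, dist_zero_right, EuclideanSpace.norm_eq, Real.sqrt_le_iff]
  simp

theorem mem_sph_iff (x : EuclideanSpace ℝ (Fin 2)) :
    x ∈ Metric.sphere (0 : EuclideanSpace ℝ (Fin 2)) 1 ↔ x 0 ^ 2 + x 1 ^ 2 = 1 := by
  rw [mem_sphere_iff_norm, sub_zero, EuclideanSpace.norm_eq, Real.sqrt_eq_one]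
  simp

theorem jj_sq (t : JJ) : (t:ℝ)^2 ≤ 1 := by
  have := t.2.1; have := t.2.2; nlinarith

/-- coordinates on the disc adapted to the edge `e` : `v = 0` on `e`, `v = 1` on the other edge -/
def ddv (b : Bool) (v : II) (t : JJ) : EuclideanSpace ℝ (Fin 2) :=
  !₂[eps b * (1 - 2 * (v:ℝ)) * Real.sqrt (1 - (t:ℝ)^2), (t:ℝ)]

theorem ddv_mem (b : Bool) (v : II) (t : JJ) : ddv b v t ∈ Disc := by
  rw [mem_Disc_iff]
  have h1 := Real.sq_sqrt (sub_nonneg.2 (jj_sq t))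
  have h2 : (1 - 2 * (v:ℝ))^2 ≤ 1 := by
    have := v.2.1; have := v.2.2; nlinarith
  have h3 := jj_sq t
  simp only [ddv, PiLp.toLp_apply, Matrix.cons_val_zero, Matrix.cons_val_one]
  rw [mul_pow, mul_pow, h1, pow_two (eps b), eps_sq]
  nlinarith

def dd {r : ℕ} (e : Fin r × Bool) (v : II) (t : JJ) : DiscUnion r := ⟨e.1, ⟨ddv e.2 v t, ddv_mem _ _ _⟩⟩

theorem dd_continuous {r : ℕ} (e : Fin r × Bool) : Continuous (fun w : II × JJ => dd e w.1 w.2) := by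
  unfold dd ddv
  refine continuous_sigmaMk.comp (Continuous.subtype_mk ?_ _)
  fun_prop

/-- height -/
def ht {r : ℕ} (p : DiscUnion r) : ℝ := (p.2 : EuclideanSpace ℝ (Fin 2)) 1

theorem ht_continuous {r : ℕ} : Continuous (ht (r := r)) := by
  unfold ht
  refine continuous_sigma fun s => ?_
  fun_prop

theorem ht_mem {r : ℕ} (p : DiscUnion r) : ht p ∈ Set.Icc (-1:ℝ) 1 := by
  have := (mem_Disc_iff _).1 p.2.2
  unfold ht
  constructor <;> nlinarith [sq_nonneg ((p.2 : EuclideanSpace ℝ (Fin 2)) 0)]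

@[simp] theorem ht_dd {r : ℕ} (e : Fin r × Bool) (v t) : ht (dd e v t) = t := by
  simp [ht, dd, ddv]

def tau {r : ℕ} (e : Fin r × Bool) : Fin r × Bool := (e.1, !e.2)

theorem dd_ext {r : ℕ} (p : DiscUnion r) (e : Fin r × Bool) (v : II) (t : JJ) (h1 : p.1 = e.1)
    (h2 : (p.2 : EuclideanSpace ℝ (Fin 2)) 0 = eps e.2 * (1 - 2 * (v:ℝ)) * Real.sqrt (1 - (t:ℝ)^2))
    (h3 : (p.2 : EuclideanSpace ℝ (Fin 2)) 1 = t) : p = dd e v t := by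
  obtain ⟨s, x, hx⟩ := p
  simp only at h1 h2 h3
  subst h1
  unfold dd
  congr
  ext i
  fin_cases i
  · simpa [ddv] using h2
  · simpa [ddv] using h3

theorem dd_tau {r : ℕ} (e : Fin r × Bool) (t) : dd (tau e) i0 t = dd e i1 t := by
  apply dd_ext
  · rfl
  · simp [dd, ddv, tau, eps_not, i0, i1]; ring
  · simp [dd, ddv]

theorem dd_tau' {r : ℕ} (e : Fin r × Bool) (t) : dd (tau e) i1 t = dd e i0 t := by
  apply dd_ext
  · rfl
  · simp [dd, ddv, tau, eps_not, i0, i1]; ring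
  · simp [dd, ddv]

theorem dd_pole {r : ℕ} (e e' : Fin r × Bool) (he : e.1 = e'.1) (v v' : II) (t : JJ) (ht : (t:ℝ)^2 = 1) : dd e v t = dd e' v' t := by
  apply dd_ext
  · exact he
  · simp [dd, ddv, ht]
  · simp [dd, ddv]

theorem dd_inj {r : ℕ} (e : Fin r × Bool) (v v' : II) (t t' : JJ) (h : dd e v t = dd e v' t') :
    t = t' ∧ (v = v' ∨ (t:ℝ)^2 = 1) := by
  have h1 : t = t' := by
    have := congrArg ht h
    simpa [Subtype.ext_iff] using this
  refine ⟨h1, ?_⟩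
  subst h1
  by_cases h2 : (t:ℝ)^2 = 1
  · exact Or.inr h2
  left
  have h3 := congrArg (fun p : DiscUnion r => (p.2 : EuclideanSpace ℝ (Fin 2)) 0) h
  simp only [dd, ddv, PiLp.toLp_apply, Matrix.cons_val_zero] at h3
  have h4 : Real.sqrt (1 - (t:ℝ)^2) ≠ 0 := by
    rw [Real.sqrt_ne_zero']
    exact sub_pos.2 (lt_of_le_of_ne (jj_sq t) h2)
  have h5 := mul_right_cancel₀ h4 h3
  have h6 : eps e.2 ≠ 0 := by intro h; have := eps_sq e.2; simp [h] at this
  have h7 := mul_left_cancel₀ h6 h5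
  apply Subtype.ext
  linarith

theorem dd_surj {r : ℕ} (e : Fin r × Bool) (p : DiscUnion r) (hp : p.1 = e.1) : ∃ v t, p = dd e v t := by
  have hD := (mem_Disc_iff _).1 p.2.2
  set x := (p.2 : EuclideanSpace ℝ (Fin 2)) 0 with hx
  have hy := ht_mem p
  set y := ht p with hy'
  change x^2 + y^2 ≤ 1 at hD
  have hs := eps_sq e.2
  by_cases h1 : y^2 = 1
  · refine ⟨i0, ⟨y, hy⟩, dd_ext _ _ _ _ hp ?_ rfl⟩
    have : x = 0 := by nlinarith
    simp [← hx, this, h1]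
  have h2 : 0 < 1 - y^2 := by
    rcases lt_or_eq_of_le (show y^2 ≤ 1 by nlinarith [sq_nonneg x]) with h | h
    · linarith
    · exact absurd h h1
  have h3 := Real.sqrt_pos.2 h2
  have h4 := Real.sq_sqrt h2.le
  set S := Real.sqrt (1 - y^2) with hS
  have h5 : |eps e.2 * x / S| ≤ 1 := by
    rw [abs_div, abs_of_pos h3, div_le_one h3]
    apply abs_le_of_sq_le_sq _ h3.le
    nlinarith
  rw [abs_le] at h5
  refine ⟨⟨(1 - eps e.2 * x / S)/2, by constructor <;> linarith⟩, ⟨y, hy⟩, dd_ext _ _ _ _ hp ?_ rfl⟩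
  change x = eps e.2 * (1 - 2 * ((1 - eps e.2 * x / S)/2)) * S
  field_simp
  linear_combination (-x) * hs

theorem dd_mem_arc {r : ℕ} (e : Fin r × Bool) (t) : dd e i0 t ∈ arc e := by
  have h1 := Real.sq_sqrt (sub_nonneg.2 (jj_sq t))
  refine ⟨rfl, ?_, ?_⟩
  · rw [mem_sph_iff]
    simp [dd, ddv, i0, mul_pow, h1, pow_two (eps e.2), eps_sq]
  · rcases e with ⟨s, b⟩
    cases b <;> simp [dd, ddv, eps, i0, Real.sqrt_nonneg]

theorem arc_surj {r : ℕ} (e : Fin r × Bool) (p) (hp : p ∈ arc e) : p = dd e i0 ⟨ht p, ht_mem p⟩ := by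
  obtain ⟨h1, h2, h3⟩ := hp
  rw [mem_sph_iff] at h2
  refine dd_ext _ _ _ _ h1 ?_ rfl
  change _ = eps e.2 * (1 - 2 * (0:ℝ)) * Real.sqrt (1 - ((p.2 : EuclideanSpace ℝ (Fin 2)) 1)^2)
  rw [show 1 - ((p.2 : EuclideanSpace ℝ (Fin 2)) 1)^2 = ((p.2 : EuclideanSpace ℝ (Fin 2)) 0)^2 by linarith, Real.sqrt_sq_eq_abs]
  rcases e with ⟨s, b⟩
  cases b
  · simp at h3
    simp [eps, abs_of_nonpos h3]
  · simp at h3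
    simp [eps, abs_of_nonneg h3]

theorem dd_jP {r : ℕ} (e : Fin r × Bool) (v) : dd e v jP = ⟨e.1, ⟨pP, pP_mem⟩⟩ := by
  symm
  apply dd_ext
  · rfl
  · simp [pP, jP]
  · simp [pP, jP]

theorem dd_jM {r : ℕ} (e : Fin r × Bool) (v) : dd e v jM = ⟨e.1, ⟨pM, pM_mem⟩⟩ := by
  symm
  apply dd_ext
  · rfl
  · simp [pM, jM]
  · simp [pM, jM]

/-! Model maps onto the sphere and the projective plane. -/

abbrev S2 : Type := ↥(Metric.sphere (0 : EuclideanSpace ℝ (Fin 3)) 1)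

theorem mem_S2_iff (x : EuclideanSpace ℝ (Fin 3)) :
    x ∈ Metric.sphere (0 : EuclideanSpace ℝ (Fin 3)) 1 ↔ x 0 ^ 2 + x 1 ^ 2 + x 2 ^ 2 = 1 := by
  rw [mem_sphere_iff_norm, sub_zero, EuclideanSpace.norm_eq, Real.sqrt_eq_one]
  simp [Fin.sum_univ_three]

def sph (c : ℝ) (a : II) (z : JJ) : S2 :=
  ⟨!₂[Real.sqrt (1 - (z:ℝ)^2) * Real.cos (c * a), Real.sqrt (1 - (z:ℝ)^2) * Real.sin (c * a), (z:ℝ)], by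
    have h1 := Real.sq_sqrt (sub_nonneg.2 (jj_sq z))
    have h2 := Real.sin_sq_add_cos_sq (c * a)
    rw [mem_S2_iff]
    simp only [PiLp.toLp_apply, Matrix.cons_val]
    rw [mul_pow, mul_pow, h1]
    linear_combination (1 - (z:ℝ)^2) * h2⟩

theorem sph_continuous (c : ℝ) : Continuous (fun w : II × JJ => sph c w.1 w.2) := by
  unfold sph
  fun_prop

theorem sph_ext (c : ℝ) (a : II) (z : JJ) (x : S2) (h0 : x.1 0 = Real.sqrt (1 - (z:ℝ)^2) * Real.cos (c * a))
    (h1 : x.1 1 = Real.sqrt (1 - (z:ℝ)^2) * Real.sin (c * a)) (h2 : x.1 2 = z) : x = sph c a z := by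
  apply Subtype.ext
  ext i
  fin_cases i
  · simpa [sph] using h0
  · simpa [sph] using h1
  · simpa [sph] using h2

theorem sph_coords (c : ℝ) (a : II) (z : JJ) : (sph c a z).1 0 = Real.sqrt (1 - (z:ℝ)^2) * Real.cos (c * a) ∧
    (sph c a z).1 1 = Real.sqrt (1 - (z:ℝ)^2) * Real.sin (c * a) ∧ (sph c a z).1 2 = z := by
  simp [sph]

theorem jj_sqrt (z : JJ) (h : (z:ℝ)^2 ≠ 1) : Real.sqrt (1 - (z:ℝ)^2) ≠ 0 := by
  rw [Real.sqrt_ne_zero']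
  exact sub_pos.2 (lt_of_le_of_ne (jj_sq z) h)

/-- the kernel relation of the model maps -/
def Ker (σ : ℝ) (a a' : II) (z z' : JJ) : Prop :=
  (a = a' ∧ z = z') ∨ ((z:ℝ)^2 = 1 ∧ (z':ℝ)^2 = 1 ∧ (z = z' ∨ σ = -1)) ∨
  (a = i0 ∧ a' = i1 ∧ (z':ℝ) = σ * z) ∨ (a = i1 ∧ a' = i0 ∧ (z:ℝ) = σ * z')

theorem polar_half (x y : ℝ) (hy : 0 ≤ y) : ∃ θ : ℝ, 0 ≤ θ ∧ θ ≤ Real.pi ∧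
    x = Real.sqrt (x^2+y^2) * Real.cos θ ∧ y = Real.sqrt (x^2+y^2) * Real.sin θ := by
  refine ⟨Complex.arg ⟨x, y⟩, Complex.arg_nonneg_iff.2 hy, Complex.arg_le_pi _, ?_, ?_⟩
  · have := Complex.norm_mul_cos_arg ⟨x, y⟩
    rw [Complex.norm_def, Complex.normSq_mk, ← pow_two, ← pow_two] at this
    exact this.symm
  · have := Complex.norm_mul_sin_arg ⟨x, y⟩
    rw [Complex.norm_def, Complex.normSq_mk, ← pow_two, ← pow_two] at this
    exact this.symm

theorem S2_z (x : S2) : x.1 2 ∈ Set.Icc (-1:ℝ) 1 := by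
  have := (mem_S2_iff _).1 x.2
  constructor <;> nlinarith [sq_nonneg (x.1 0), sq_nonneg (x.1 1)]

theorem sph_half (x : S2) (hx : 0 ≤ x.1 1) : ∃ a z, x = sph Real.pi a z := by
  obtain ⟨θ, h0, h1, h2, h3⟩ := polar_half (x.1 0) (x.1 1) hx
  have h4 : x.1 0 ^ 2 + x.1 1 ^ 2 = 1 - (x.1 2)^2 := by
    linarith [(mem_S2_iff _).1 x.2]
  rw [h4] at h2 h3
  have hp := Real.pi_pos
  have h5 : Real.pi * (θ / Real.pi) = θ := by field_simp
  refine ⟨⟨θ / Real.pi, by positivity, by rw [div_le_one hp]; exact h1⟩, ⟨x.1 2, S2_z x⟩, sph_ext _ _ _ _ ?_ ?_ rfl⟩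
  · simp only [h5]; exact h2
  · simp only [h5]; exact h3

theorem sph_full (x : S2) : ∃ a z, x = sph (2 * Real.pi) a z := by
  have h4 : x.1 0 ^ 2 + x.1 1 ^ 2 = 1 - (x.1 2)^2 := by
    linarith [(mem_S2_iff _).1 x.2]
  have hp := Real.pi_pos
  rcases le_total 0 (x.1 1) with hx | hx
  · obtain ⟨θ, h0, h1, h2, h3⟩ := polar_half (x.1 0) (x.1 1) hx
    rw [h4] at h2 h3
    have h5 : 2 * Real.pi * (θ / (2 * Real.pi)) = θ := by field_simp
    refine ⟨⟨θ / (2 * Real.pi), by positivity, by rw [div_le_one (by positivity)]; linarith⟩, ⟨x.1 2, S2_z x⟩, sph_ext _ _ _ _ ?_ ?_ rfl⟩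
    · simp only [h5]; exact h2
    · simp only [h5]; exact h3
  · obtain ⟨θ, h0, h1, h2, h3⟩ := polar_half (x.1 0) (-x.1 1) (by linarith)
    rw [neg_sq, h4] at h2 h3
    have h5 : 2 * Real.pi * (1 - θ / (2 * Real.pi)) = 2 * Real.pi - θ := by field_simp
    have h6 : θ / (2 * Real.pi) ≤ 1 := by rw [div_le_one (by positivity)]; linarith
    have h7 : 0 ≤ θ / (2 * Real.pi) := by positivity
    refine ⟨⟨1 - θ / (2 * Real.pi), by linarith, by linarith⟩, ⟨x.1 2, S2_z x⟩, sph_ext _ _ _ _ ?_ ?_ rfl⟩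
    · simp only [h5, Real.cos_two_pi_sub]; exact h2
    · simp only [h5, Real.sin_two_pi_sub]; linarith

theorem sph_pole (c : ℝ) (a a' : II) (z : JJ) (h : (z:ℝ)^2 = 1) : sph c a z = sph c a' z := by
  apply sph_ext <;> simp [sph, h]

theorem sph_ker (a a' : II) (z z' : JJ) : sph (2 * Real.pi) a z = sph (2 * Real.pi) a' z' ↔ Ker 1 a a' z z' := by
  have hp := Real.pi_pos
  constructor
  · intro h
    obtain ⟨p0, p1, p2⟩ := sph_coords (2 * Real.pi) a z
    obtain ⟨q0, q1, q2⟩ := sph_coords (2 * Real.pi) a' z'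
    rw [h] at p0 p1 p2
    rw [q0] at p0
    rw [q1] at p1
    rw [q2] at p2
    have hz : z = z' := Subtype.ext p2.symm
    subst hz
    by_cases hz : (z:ℝ)^2 = 1
    · exact Or.inr (Or.inl ⟨hz, hz, Or.inl rfl⟩)
    have hs := jj_sqrt z hz
    have hc := mul_left_cancel₀ hs p0
    have hs := mul_left_cancel₀ hs p1
    have hd : Real.cos (2 * Real.pi * a' - 2 * Real.pi * a) = 1 := by
      rw [Real.cos_sub, hc, hs]
      linarith [Real.sin_sq_add_cos_sq (2 * Real.pi * a)]
    rw [Real.cos_eq_one_iff] at hd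
    obtain ⟨k, hk⟩ := hd
    have hk' : (k:ℝ) = a' - a := by
      have : (2 * Real.pi) * (k:ℝ) = (2 * Real.pi) * (a' - a) := by linarith
      exact mul_left_cancel₀ (by positivity) this
    have b1 := a.2.1
    have b2 := a.2.2
    have b3 := a'.2.1
    have b4 := a'.2.2
    have k1 : -1 ≤ k := by
      have : (-1:ℝ) ≤ k := by linarith
      exact_mod_cast this
    have k2 : k ≤ 1 := by
      have : (k:ℝ) ≤ 1 := by linarith
      exact_mod_cast this
    have : k = -1 ∨ k = 0 ∨ k = 1 := by omega
    rcases this with h | h | h <;> subst h <;> push_cast at hk'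
    · right; right; right
      refine ⟨Subtype.ext (show (a:ℝ) = 1 by linarith), Subtype.ext (show (a':ℝ) = 0 by linarith), by ring⟩
    · left
      exact ⟨Subtype.ext (by linarith), rfl⟩
    · right; right; left
      refine ⟨Subtype.ext (show (a:ℝ) = 0 by linarith), Subtype.ext (show (a':ℝ) = 1 by linarith), by ring⟩
  · rintro (⟨h1, h2⟩ | ⟨h1, h2, h3⟩ | ⟨h1, h2, h3⟩ | ⟨h1, h2, h3⟩)
    · rw [h1, h2]
    · have : z = z' := by
        rcases h3 with h3 | h3
        · exact h3
        · norm_num at h3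
      subst this
      exact sph_pole _ _ _ _ h1
    · subst h1 h2
      have : z = z' := Subtype.ext (by linarith)
      subst this
      apply sph_ext <;> simp [sph, i0, i1]
    · subst h1 h2
      have : z = z' := Subtype.ext (by linarith)
      subst this
      apply sph_ext <;> simp [sph, i0, i1]

def pmk (x : S2) : ProjPlane := Quot.mk _ x

theorem pmk_eq (x y : S2) : pmk x = pmk y ↔ (x = y ∨ (y : EuclideanSpace ℝ (Fin 3)) = - x) := by
  constructor
  · intro h
    have h' := Quot.eqvGen_exact h
    clear h
    induction h' with
    | rel x y h => exact Or.inr h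
    | refl => exact Or.inl rfl
    | symm x y _ ih =>
      rcases ih with h | h
      · exact Or.inl h.symm
      · right; rw [h, neg_neg]
    | trans x y z hxy hyz ih1 ih2 =>
      rcases ih1 with h1 | h1 <;> rcases ih2 with h2 | h2
      · exact Or.inl (h1.trans h2)
      · right; rw [h2, h1]
      · right; rw [← h2, h1]
      · left; apply Subtype.ext; rw [h2, h1, neg_neg]
  · rintro (h | h)
    · rw [h]
    · exact Quot.sound h

theorem S2_prod (x y : S2) (h : ∀ i j, x.1 i * x.1 j = y.1 i * y.1 j) :
    x = y ∨ (y : EuclideanSpace ℝ (Fin 3)) = - x := by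
  have hy := (mem_S2_iff _).1 y.2
  have hx := (mem_S2_iff _).1 x.2
  have hc : ∀ i, y.1 i = (x.1 0 * y.1 0 + x.1 1 * y.1 1 + x.1 2 * y.1 2) * x.1 i := by
    intro i
    linear_combination (-(y.1 i)) * hy - y.1 0 * h 0 i - y.1 1 * h 1 i - y.1 2 * h 2 i
  set c := x.1 0 * y.1 0 + x.1 1 * y.1 1 + x.1 2 * y.1 2 with hcdef
  have h1 : c^2 = 1 := by
    have : (y.1 0)^2 + (y.1 1)^2 + (y.1 2)^2 = c^2 * ((x.1 0)^2 + (x.1 1)^2 + (x.1 2)^2) := by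
      linear_combination (y.1 0 + c * x.1 0) * hc 0 + (y.1 1 + c * x.1 1) * hc 1 + (y.1 2 + c * x.1 2) * hc 2
    rw [hx, hy] at this
    linarith
  rcases (show c = 1 ∨ c = -1 from by simpa using h1) with h2 | h2
  · left
    apply Subtype.ext
    ext i
    rw [hc i, h2, one_mul]
  · right
    ext i
    rw [hc i, h2]
    simp

instance : T2Space ProjPlane := by
  let f : ProjPlane → (Fin 3 → Fin 3 → ℝ) := Quot.lift (fun x i j => x.1 i * x.1 j) (by
    intro x y h
    ext i j
    simp only [h]
    simp)
  refine T2Space.of_injective_continuous (f := f) ?_ ?_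
  · intro x y
    induction x using Quot.ind
    induction y using Quot.ind
    intro h
    exact (pmk_eq _ _).2 (S2_prod _ _ fun i j => congrFun (congrFun h i) j)
  · refine continuous_quot_lift _ ?_
    fun_prop

theorem proj_surj (x : ProjPlane) : ∃ a z, x = pmk (sph Real.pi a z) := by
  induction x using Quot.ind
  rename_i x
  rcases le_total 0 (x.1 1) with hx | hx
  · obtain ⟨a, z, h⟩ := sph_half x hx
    exact ⟨a, z, congrArg pmk h⟩
  · obtain ⟨a, z, h⟩ := sph_half (-x) (by simpa using hx)
    refine ⟨a, z, ?_⟩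
    rw [← h]
    exact (pmk_eq _ _).2 (Or.inr (by simp))

theorem proj_ker (a a' : II) (z z' : JJ) : pmk (sph Real.pi a z) = pmk (sph Real.pi a' z') ↔ Ker (-1) a a' z z' := by
  have hp := Real.pi_pos
  obtain ⟨p0, p1, p2⟩ := sph_coords Real.pi a z
  obtain ⟨q0, q1, q2⟩ := sph_coords Real.pi a' z'
  have b1 := a.2.1
  have b2 := a.2.2
  have b3 := a'.2.1
  have b4 := a'.2.2
  rw [pmk_eq]
  constructor
  · rintro (h | h)
    · rw [h] at p0 p1 p2
      rw [q0] at p0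
      rw [q2] at p2
      have hz : z = z' := Subtype.ext p2.symm
      subst hz
      by_cases hz : (z:ℝ)^2 = 1
      · exact Or.inr (Or.inl ⟨hz, hz, Or.inl rfl⟩)
      have hs := jj_sqrt z hz
      have hc := mul_left_cancel₀ hs p0
      have := Real.injOn_cos (show Real.pi * (a':ℝ) ∈ Set.Icc 0 Real.pi by constructor <;> nlinarith)
        (show Real.pi * (a:ℝ) ∈ Set.Icc 0 Real.pi by constructor <;> nlinarith) hc
      exact Or.inl ⟨Subtype.ext (mul_left_cancel₀ hp.ne' this).symm, rfl⟩
    · rw [h] at q0 q1 q2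
      simp only [PiLp.neg_apply] at q0 q1 q2
      rw [p0] at q0
      rw [p1] at q1
      rw [p2] at q2
      by_cases hz : (z:ℝ)^2 = 1
      · exact Or.inr (Or.inl ⟨hz, by rw [← q2, neg_sq, hz], Or.inr rfl⟩)
      have hs := jj_sqrt z hz
      rw [← q2, neg_sq, ← mul_neg] at q0 q1
      have hc := mul_left_cancel₀ hs q0
      have hs := mul_left_cancel₀ hs q1
      have s1 := Real.sin_nonneg_of_nonneg_of_le_pi (x := Real.pi * a) (by positivity) (by nlinarith)
      have s2 := Real.sin_nonneg_of_nonneg_of_le_pi (x := Real.pi * a') (by positivity) (by nlinarith)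
      rw [← Real.cos_pi_sub] at hc
      have hd := Real.injOn_cos (show Real.pi - Real.pi * (a:ℝ) ∈ Set.Icc 0 Real.pi by constructor <;> nlinarith)
        (show Real.pi * (a':ℝ) ∈ Set.Icc 0 Real.pi by constructor <;> nlinarith) hc
      have ha : (a':ℝ) = 1 - a := mul_left_cancel₀ hp.ne' (by linarith)
      have s0 : Real.sin (Real.pi * a) = 0 := by linarith
      have : (a:ℝ) = 0 ∨ (a:ℝ) = 1 := by
        by_contra hcon
        push Not at hcon
        have t1 : 0 < (a:ℝ) := lt_of_le_of_ne b1 (Ne.symm hcon.1)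
        have t2 : (a:ℝ) < 1 := lt_of_le_of_ne b2 hcon.2
        have := Real.sin_pos_of_pos_of_lt_pi (x := Real.pi * a) (by positivity) (by nlinarith)
        linarith
      right; right
      rcases this with h | h
      · left
        exact ⟨Subtype.ext h, Subtype.ext (by rw [ha, h]; simp [i1]), by linarith⟩
      · right
        exact ⟨Subtype.ext h, Subtype.ext (by rw [ha, h]; simp [i0]), by linarith⟩
  · rintro (⟨h1, h2⟩ | ⟨h1, h2, h3⟩ | ⟨h1, h2, h3⟩ | ⟨h1, h2, h3⟩)
    · left; rw [h1, h2]
    · have : (z:ℝ) = z' ∨ (z:ℝ) = - z' := sq_eq_sq_iff_eq_or_eq_neg.1 (h1.trans h2.symm)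
      rcases this with h | h
      · left
        have := Subtype.ext h
        subst this
        exact sph_pole _ _ _ _ h1
      · right
        ext i
        fin_cases i <;> simp [sph, h1, h2, h]
    · right
      subst h1 h2
      ext i
      fin_cases i <;> simp [sph, i0, i1, h3]
    · right
      subst h1 h2
      ext i
      fin_cases i <;> simp [sph, i0, i1, h3]

theorem sq_one_cases {x : ℝ} (h : x^2 = 1) : x = 1 ∨ x = -1 := by simpa using h

theorem quot_homeo {W Y Z : Type} [TopologicalSpace W] [TopologicalSpace Y] [TopologicalSpace Z]
    {p : W → Y} {q : W → Z} (hp : Topology.IsQuotientMap p) (hq : Topology.IsQuotientMap q)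
    (h : ∀ w w', p w = p w' ↔ q w = q w') : Nonempty (Y ≃ₜ Z) := by
  obtain ⟨f, hf⟩ : ∃ f : Y → Z, ∀ w, f (p w) = q w :=
    ⟨fun y => q (Function.surjInv hp.surjective y), fun w => (h _ _).1 (Function.surjInv_eq hp.surjective _)⟩
  obtain ⟨g, hg⟩ : ∃ g : Z → Y, ∀ w, g (q w) = p w :=
    ⟨fun y => p (Function.surjInv hq.surjective y), fun w => (h _ _).2 (Function.surjInv_eq hq.surjective _)⟩
  have hfc : Continuous f := by
    rw [hp.continuous_iff]
    have : f ∘ p = q := funext hf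
    rw [this]; exact hq.continuous
  have hgc : Continuous g := by
    rw [hq.continuous_iff]
    have : g ∘ q = p := funext hg
    rw [this]; exact hp.continuous
  refine ⟨⟨⟨f, g, ?_, ?_⟩, hfc, hgc⟩⟩
  · intro y
    obtain ⟨w, rfl⟩ := hp.surjective y
    rw [hf, hg]
  · intro y
    obtain ⟨w, rfl⟩ := hq.surjective y
    rw [hg, hf]

/-- interpolation between the identity and `G` -/
def FF (G : JJ → ℝ) (v : II) (t : JJ) : ℝ := (1 - (v:ℝ)) * t + v * G t

theorem FF_mono (G : JJ → ℝ) (hG : StrictMono G) (v : II) : StrictMono (FF G v) := by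
  intro s t hst
  have h1 := hG hst
  have h2 : (s:ℝ) < t := hst
  have b1 := v.2.1
  have b2 := v.2.2
  unfold FF
  rcases eq_or_lt_of_le b1 with h | h
  · rw [← h]; linarith
  · nlinarith [mul_pos h (sub_pos.2 h1), mul_nonneg (sub_nonneg.2 b2) (sub_pos.2 h2).le]

theorem FF_P (G : JJ → ℝ) (hP : G jP = 1) (v : II) : FF G v jP = 1 := by
  rw [FF, hP]; simp [jP]

theorem FF_M (G : JJ → ℝ) (hP : G jM = -1) (v : II) : FF G v jM = -1 := by
  rw [FF, hP]; simp only [jM]; ring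

theorem jj_pole (t : JJ) (ht : (t:ℝ)^2 = 1) : t = jP ∨ t = jM := by
  rcases sq_one_cases ht with h | h
  · exact Or.inl (Subtype.ext h)
  · exact Or.inr (Subtype.ext h)

theorem FF_mem (G : JJ → ℝ) (hG : StrictMono G) (hP : G jP = 1) (hM : G jM = -1) (v : II) (t : JJ) :
    -1 ≤ FF G v t ∧ FF G v t ≤ 1 := by
  have h := (FF_mono G hG v).monotone
  have h1 := h (show t ≤ jP from t.2.2)
  have h2 := h (show jM ≤ t from t.2.1)
  rw [FF_P G hP] at h1
  rw [FF_M G hM] at h2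
  exact ⟨h2, h1⟩

theorem FF_sq (G : JJ → ℝ) (hG : StrictMono G) (hP : G jP = 1) (hM : G jM = -1) (v : II) (t : JJ)
    (h : (FF G v t)^2 = 1) : (t:ℝ)^2 = 1 ∧ FF G v t = t := by
  have hi := (FF_mono G hG v).injective
  rcases sq_one_cases h with h | h
  · have : t = jP := hi (h.trans (FF_P G hP v).symm)
    rw [h, this]; simp [jP]
  · have : t = jM := hi (h.trans (FF_M G hM v).symm)
    rw [h, this]; simp [jM]

theorem FF_pole (G : JJ → ℝ) (hP : G jP = 1) (hM : G jM = -1) (v : II) (t : JJ)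
    (h : (t:ℝ)^2 = 1) : FF G v t = t := by
  rcases jj_pole t h with h | h
  · rw [h, FF_P G hP]; rfl
  · rw [h, FF_M G hM]; rfl

theorem FF_surj (G : JJ → ℝ) (hc : Continuous G) (hP : G jP = 1) (hM : G jM = -1) (v : II) (z : ℝ)
    (h1 : -1 ≤ z) (h2 : z ≤ 1) : ∃ t, FF G v t = z := by
  have : PreconnectedSpace JJ := Subtype.preconnectedSpace isPreconnected_Icc
  have hFc : Continuous (FF G v) := by unfold FF; fun_prop
  exact mem_range_of_exists_le_of_exists_ge hFc ⟨jM, by rw [FF_M G hM]; exact h1⟩ ⟨jP, by rw [FF_P G hP]; exact h2⟩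

theorem glue_core {r n : ℕ} (hn : 0 < n) (E : ℕ → Fin r × Bool) (H : ℕ → JJ → JJ) (σ : ℕ → ℝ)
    {Y Z : Type} [TopologicalSpace Y] [TopologicalSpace Z] [T2Space Z]
    (P : DiscUnion r → Y) (hP : Topology.IsQuotientMap P)
    (hσ0 : σ 0 = 1) (hσ : ∀ i, σ i * σ i = 1) (Hc : ∀ i, Continuous (H i))
    (hmono : ∀ i, StrictMono (fun t => σ i * σ (i+1) * (H i t : ℝ)))
    (hHP : ∀ i, σ i * σ (i+1) * (H i jP : ℝ) = 1) (hHM : ∀ i, σ i * σ (i+1) * (H i jM : ℝ) = -1)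
    (Eper : E n = E 0) (Einj : ∀ i < n, ∀ j < n, (E i).1 = (E j).1 → i = j)
    (Esurj : ∀ s, ∃ i < n, (E i).1 = s)
    (Prel : ∀ i t, P (dd (E i) i1 t) = P (dd (E (i+1)) i0 (H i t)))
    (Plift : ∀ g : DiscUnion r → Z,
      (∀ i < n, ∀ t, g (dd (E i) i1 t) = g (dd (E (i+1)) i0 (H i t))) → ∀ x y, P x = P y → g x = g y)
    (Ψ : II → JJ → Z) (hΨ : Continuous (fun w : II × JJ => Ψ w.1 w.2))
    (Ψsurj : ∀ x, ∃ a z, x = Ψ a z)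
    (Ψker : ∀ a a' z z', Ψ a z = Ψ a' z' ↔ Ker (σ n) a a' z z') :
    Nonempty (Y ≃ₜ Z) ∧ ((P (dd (E 0) i0 jP) = P (dd (E 0) i0 jM)) ↔ σ n = -1) ∧
      (σ n = 1 → ∀ s, P ⟨s, ⟨pP, pP_mem⟩⟩ ≠ P ⟨s, ⟨pM, pM_mem⟩⟩) := by
  have hnR : (0:ℝ) < n := by exact_mod_cast hn
  set G : ℕ → JJ → ℝ := fun i t => σ i * σ (i+1) * (H i t : ℝ) with hG
  have hGc : ∀ i, Continuous (G i) := fun i => by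
    have := Hc i
    simp only [hG]; fun_prop
  have hFm := fun i => FF_mem (G i) (hmono i) (hHP i) (hHM i)
  have hσ1 : ∀ i, σ i = 1 ∨ σ i = -1 := fun i => by simpa using (show (σ i)^2 = 1 by rw [pow_two]; exact hσ i)
  obtain ⟨A, hA⟩ : ∃ A : ℕ → II → II, ∀ i v, i < n → (A i v : ℝ) = (i + v) / n := by
    refine ⟨fun i v => if h : i < n then ⟨(i + v) / n, ?_, ?_⟩ else i0, ?_⟩
    · have := v.2.1; positivity
    · rw [div_le_one hnR]
      have h1 := v.2.2
      have : (i:ℝ) + 1 ≤ n := by exact_mod_cast h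
      linarith
    · intro i v h
      simp [h]
  obtain ⟨B, hB⟩ : ∃ B : ℕ → II → JJ → JJ, ∀ i v t, (B i v t : ℝ) = σ i * FF (G i) v t := by
    refine ⟨fun i v t => ⟨σ i * FF (G i) v t, ?_⟩, fun _ _ _ => rfl⟩
    have := hFm i v t
    rcases hσ1 i with h | h <;> rw [h] <;> constructor <;> linarith
  have hB0 : ∀ i t, (B i i0 t : ℝ) = σ i * t := fun i t => by rw [hB, FF]; simp [i0]
  have hB1 : ∀ i t, (B i i1 t : ℝ) = σ (i+1) * H i t := fun i t => by
    rw [hB, FF]; simp only [i1, hG]; linear_combination (σ (i+1) * H i t) * hσ i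
  have hBsq : ∀ i v t, (B i v t : ℝ)^2 = 1 → (t:ℝ)^2 = 1 ∧ (B i v t : ℝ) = σ i * t := by
    intro i v t h
    have h1 : (FF (G i) v t)^2 = 1 := by
      rw [hB, mul_pow, pow_two (σ i), hσ, one_mul] at h; exact h
    obtain ⟨h2, h3⟩ := FF_sq (G i) (hmono i) (hHP i) (hHM i) v t h1
    exact ⟨h2, by rw [hB, h3]⟩
  have hBpole : ∀ i v (t : JJ), (t:ℝ)^2 = 1 → (B i v t : ℝ) = σ i * t := by
    intro i v t h
    rw [hB, FF_pole (G i) (hHP i) (hHM i) v t h]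
  let W := Fin n × (II × JJ)
  let D : W → DiscUnion r := fun w => dd (E w.1) w.2.1 w.2.2
  let q : W → Z := fun w => Ψ (A w.1 w.2.1) (B w.1 w.2.1 w.2.2)
  have hDc : Continuous D := by
    rw [continuous_prod_of_discrete_left]
    intro i
    exact dd_continuous (E i)
  have hDs : Function.Surjective D := by
    intro x
    obtain ⟨i, hi, h⟩ := Esurj x.1
    obtain ⟨v, t, h'⟩ := dd_surj (E i) x h.symm
    exact ⟨(⟨i, hi⟩, v, t), h'.symm⟩
  have hqc : Continuous q := by
    rw [continuous_prod_of_discrete_left]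
    intro i
    have h1 : Continuous (fun w : II × JJ => (A i w.1, B i w.1 w.2)) := by
      refine Continuous.prodMk ?_ ?_
      · rw [continuous_induced_rng]
        have : (Subtype.val ∘ fun w : II × JJ => A i w.1) = fun w : II × JJ => ((i:ℝ) + w.1) / n := by
          funext w; exact hA i w.1 i.2
        rw [this]; fun_prop
      · rw [continuous_induced_rng]
        have : (Subtype.val ∘ fun w : II × JJ => B i w.1 w.2) = fun w : II × JJ => σ i * FF (G i) w.1 w.2 := by
          funext w; exact hB i w.1 w.2
        rw [this]; unfold FF
        have := hGc i
        fun_prop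
    exact hΨ.comp h1
  have hqs : Function.Surjective q := by
    intro x
    obtain ⟨a, z, rfl⟩ := Ψsurj x
    obtain ⟨i, v, hi, hav⟩ : ∃ (i : ℕ) (v : II), i < n ∧ (a:ℝ) = (i + v) / n := by
      have b1 := a.2.1
      rcases eq_or_lt_of_le a.2.2 with h | h
      · refine ⟨n - 1, i1, by omega, ?_⟩
        rw [h, Nat.cast_sub hn]; simp [i1]; field_simp
      · refine ⟨⌊(a:ℝ) * n⌋₊, ⟨a * n - ⌊(a:ℝ) * n⌋₊, ?_, ?_⟩, ?_, ?_⟩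
        · linarith [Nat.floor_le (show 0 ≤ (a:ℝ) * n by positivity)]
        · linarith [Nat.lt_floor_add_one ((a:ℝ) * n)]
        · rw [Nat.floor_lt (by positivity)]
          nlinarith
        · simp only [add_sub_cancel]; field_simp
    obtain ⟨t, ht⟩ := FF_surj (G i) (hGc i) (hHP i) (hHM i) v (σ i * z)
      (by rcases hσ1 i with h | h <;> rw [h] <;> linarith [z.2.1, z.2.2])
      (by rcases hσ1 i with h | h <;> rw [h] <;> linarith [z.2.1, z.2.2])
    refine ⟨(⟨i, hi⟩, v, t), ?_⟩
    have e1 : A i v = a := Subtype.ext (by rw [hA i v hi, hav])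
    have e2 : B i v t = z := Subtype.ext (by rw [hB, ht, ← mul_assoc, hσ, one_mul])
    change Ψ (A i v) (B i v t) = Ψ a z
    rw [e1, e2]
  have hDq : ∀ w w', D w = D w' → q w = q w' := by
    rintro ⟨i, v, t⟩ ⟨j, v', t'⟩ h
    have h1 : (E i).1 = (E j).1 := congrArg Sigma.fst h
    have h2 : i = j := Fin.ext (Einj i i.2 j j.2 h1)
    subst h2
    obtain ⟨h3, h4⟩ := dd_inj (E i) v v' t t' h
    subst h3
    rcases h4 with h4 | h4
    · rw [h4]
    · refine (Ψker _ _ _ _).2 (Or.inr (Or.inl ?_))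
      have e1 := hBpole i v t h4
      have e2 := hBpole i v' t h4
      have e3 : (σ i * (t:ℝ))^2 = 1 := by rw [mul_pow, h4, pow_two, hσ, one_mul]
      refine ⟨?_, ?_, Or.inl (Subtype.ext ?_)⟩
      · simp only [e1, e3]
      · simp only [e2, e3]
      · simp only [e1, e2]
  obtain ⟨g, hg⟩ : ∃ g : DiscUnion r → Z, ∀ w, g (D w) = q w :=
    ⟨fun y => q (Function.surjInv hDs y), fun w => hDq _ _ (Function.surjInv_eq hDs _)⟩
  have hg' : ∀ i (hi : i < n) v t, g (dd (E i) v t) = Ψ (A i v) (B i v t) :=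
    fun i hi v t => hg (⟨i, hi⟩, v, t)
  have hlift : ∀ x y, P x = P y → g x = g y := by
    apply Plift
    intro i hi t
    rw [hg' i hi]
    by_cases hi' : i + 1 < n
    · rw [hg' (i+1) hi']
      congr 1
      · apply Subtype.ext
        rw [hA _ _ hi, hA _ _ hi']
        simp [i0, i1]
      · apply Subtype.ext
        rw [hB1, hB0]
    · have hi2 : i + 1 = n := by omega
      rw [hi2, Eper, hg' 0 hn]
      refine (Ψker _ _ _ _).2 (Or.inr (Or.inr (Or.inr ⟨?_, ?_, ?_⟩)))
      · apply Subtype.ext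
        rw [hA _ _ hi, ← hi2]; simp only [i1]; push_cast; rw [div_self]; positivity
      · apply Subtype.ext
        rw [hA _ _ hn]; simp [i0]
      · rw [hB1, hB0, hi2, hσ0, one_mul]
  -- poles
  have hHpole : ∀ i (t : JJ), (t:ℝ)^2 = 1 → σ i * σ (i+1) * (H i t : ℝ) = t := by
    intro i t h
    rcases jj_pole t h with h | h
    · rw [h, hHP]; rfl
    · rw [h, hHM]; rfl
  have hpole : ∀ i v (t t0 : JJ), (t:ℝ)^2 = 1 → (t0:ℝ) = σ i * t → P (dd (E i) v t) = P (dd (E 0) i0 t0) := by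
    intro i
    induction i with
    | zero =>
      intro v t t0 h h0
      have : t0 = t := Subtype.ext (by rw [h0, hσ0, one_mul])
      rw [this, dd_pole (E 0) (E 0) rfl v i0 t h]
    | succ i ih =>
      intro v t t0 h h0
      obtain ⟨t1, ht1⟩ : ∃ t1 : JJ, (t1:ℝ) = σ i * σ (i+1) * t := by
        refine ⟨⟨σ i * σ (i+1) * t, ?_⟩, rfl⟩
        have := t.2.1
        have := t.2.2
        rcases hσ1 i with h | h <;> rcases hσ1 (i+1) with h' | h' <;> rw [h, h'] <;> constructor <;> linarith
      have ht1' : (t1:ℝ)^2 = 1 := by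
        rw [ht1, mul_pow, mul_pow, h, pow_two, pow_two, hσ, hσ]; norm_num
      have h2 : H i t1 = t := by
        have := hHpole i t1 ht1'
        apply Subtype.ext
        rw [ht1] at this
        have h3 : σ i * σ (i+1) ≠ 0 := by
          intro h0
          have e := hσ i
          have e' := hσ (i+1)
          have : (σ i * σ (i+1)) * (σ i * σ (i+1)) = 1 := by linear_combination (σ (i+1) * σ (i+1)) * e + e'
          rw [h0] at this
          norm_num at this
        exact mul_left_cancel₀ h3 this
      rw [dd_pole (E (i+1)) (E (i+1)) rfl v i0 t h, ← h2, ← Prel]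
      exact ih _ _ _ ht1' (by rw [h0, ht1]; linear_combination (- (σ (i+1)) * (t:ℝ)) * hσ i)
  have hpm : σ n = -1 → P (dd (E 0) i0 jP) = P (dd (E 0) i0 jM) := by
    intro h
    rw [← hpole n i0 jP jM (by simp [jP]) (by rw [h]; simp [jP, jM]), Eper]
  -- neighbouring bigons
  have hstep : ∀ i j v v' t t', i < n → j < n → i ≤ j → A i v = A j v' → B i v t = B j v' t' →
      P (dd (E i) v t) = P (dd (E j) v' t') := by
    intro i j v v' t t' hi hj hij h1 h2
    have h3 := congrArg Subtype.val h1
    have h4 := congrArg Subtype.val h2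
    rw [hA _ _ hi, hA _ _ hj, div_left_inj' hnR.ne'] at h3
    rcases eq_or_lt_of_le hij with h | h
    · subst h
      have hv : v = v' := Subtype.ext (by linarith)
      subst hv
      rw [hB, hB] at h4
      have h5 : σ i ≠ 0 := by
        intro h0
        have := hσ i
        simp [h0] at this
      rw [(FF_mono (G i) (hmono i) v).injective (mul_left_cancel₀ h5 h4)]
    · have h5 : (i:ℝ) + 1 ≤ j := by exact_mod_cast h
      have b1 := v.2.2
      have b2 := v'.2.1
      have hv : v = i1 := Subtype.ext (show (v:ℝ) = 1 by linarith)
      have hv' : v' = i0 := Subtype.ext (show (v':ℝ) = 0 by linarith)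
      have hj : j = i + 1 := by
        have : (j:ℝ) = i + 1 := by linarith
        exact_mod_cast this
      subst hv hv' hj
      rw [hB1, hB0] at h4
      have h5 : σ (i+1) ≠ 0 := by
        intro h0
        have := hσ (i+1)
        simp [h0] at this
      rw [Prel, Subtype.ext (mul_left_cancel₀ h5 h4)]
  have hwrap : ∀ i j v v' t t', i < n → j < n → A i v = i0 → A j v' = i1 → (B j v' t' : ℝ) = σ n * B i v t →
      P (dd (E i) v t) = P (dd (E j) v' t') := by
    intro i j v v' t t' hi hj h1 h2 h4
    have h1' := congrArg Subtype.val h1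
    have h2' := congrArg Subtype.val h2
    rw [hA _ _ hi] at h1'
    rw [hA _ _ hj] at h2'
    simp only [i0] at h1'
    simp only [i1] at h2'
    rw [div_eq_iff hnR.ne'] at h1' h2'
    have b0 := v.2.1
    have b1 := v'.2.2
    have b2 : (j:ℝ) + 1 ≤ n := by exact_mod_cast hj
    have b3 : (0:ℝ) ≤ i := by positivity
    have hv : v = i0 := Subtype.ext (show (v:ℝ) = 0 by linarith)
    have hv' : v' = i1 := Subtype.ext (show (v':ℝ) = 1 by linarith)
    have hi0 : i = 0 := by
      have : (i:ℝ) = 0 := by linarith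
      exact_mod_cast this
    have hjn : j + 1 = n := by
      have : (j:ℝ) + 1 = n := by linarith
      exact_mod_cast this
    subst hv hv' hi0
    rw [hB1, hB0, hσ0, one_mul, hjn] at h4
    have h5 : σ n ≠ 0 := by
      intro h0
      have := hσ n
      simp [h0] at this
    rw [Prel, hjn, Eper, Subtype.ext (mul_left_cancel₀ h5 h4)]
  have hker : ∀ w w', P (D w) = P (D w') ↔ q w = q w' := by
    intro w w'
    constructor
    · intro h
      rw [← hg, ← hg]
      exact hlift _ _ h
    · obtain ⟨i, v, t⟩ := w
      obtain ⟨j, v', t'⟩ := w'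
      intro h
      change P (dd (E i) v t) = P (dd (E j) v' t')
      have h' := (Ψker _ _ _ _).1 h
      simp only at h'
      rcases h' with ⟨h1, h2⟩ | ⟨h1, h2, h3⟩ | ⟨h1, h2, h3⟩ | ⟨h1, h2, h3⟩
      · rcases le_total (i:ℕ) j with hij | hij
        · exact hstep _ _ _ _ _ _ i.2 j.2 hij h1 h2
        · exact (hstep _ _ _ _ _ _ j.2 i.2 hij h1.symm h2.symm).symm
      · obtain ⟨e1, e2⟩ := hBsq _ _ _ h1
        obtain ⟨e3, e4⟩ := hBsq _ _ _ h2
        rw [hpole _ v t _ e1 e2, hpole _ v' t' _ e3 e4]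
        rcases h3 with h3 | h3
        · rw [h3]
        · rcases jj_pole _ h1 with h1 | h1 <;> rcases jj_pole _ h2 with h2 | h2 <;> rw [h1, h2]
          · exact hpm h3
          · exact (hpm h3).symm
      · exact hwrap _ _ _ _ _ _ i.2 j.2 h1 h2 h3
      · exact (hwrap _ _ _ _ _ _ j.2 i.2 h2 h1 h3).symm
  have hpq : ∀ i (hi : i < n) v v' t t', P (dd (E i) v t) = P (dd (E i) v' t') → Ker (σ n) (A i v) (A i v') (B i v t) (B i v' t') := by
    intro i hi v v' t t' h
    exact (Ψker _ _ _ _).1 ((hker (⟨i, hi⟩, v, t) (⟨i, hi⟩, v', t')).1 h)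
  have hW : CompactSpace W := inferInstance
  have hPM : ∀ i (hi : i < n), P (dd (E i) i0 jP) = P (dd (E i) i0 jM) → σ n = -1 := by
    intro i hi h
    have h1 := hpq i hi _ _ _ _ h
    have c1 : B i i0 jP ≠ B i i0 jM := by
      intro hh
      have := congrArg Subtype.val hh
      rw [hB0, hB0] at this
      simp only [jP, jM] at this
      rcases hσ1 i with h | h <;> rw [h] at this <;> norm_num at this
    have c2 : i0 ≠ i1 := by
      intro hh
      have := congrArg Subtype.val hh
      simp [i0, i1] at this
    rcases h1 with ⟨_, h2⟩ | ⟨_, _, h3⟩ | ⟨h1, h2, h3⟩ | ⟨h1, h2, h3⟩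
    · exact absurd h2 c1
    · exact h3.resolve_left c1
    · exact absurd (h1.symm.trans h2) c2
    · exact absurd (h2.symm.trans h1) c2
  refine ⟨quot_homeo (p := P ∘ D) (q := q) ?_ ?_ hker, ⟨hPM 0 hn, hpm⟩, ?_⟩
  · refine hP.comp ?_
    have : T2Space (DiscUnion r) := inferInstance
    exact Topology.IsQuotientMap.of_surjective_continuous hDs hDc
  · exact Topology.IsQuotientMap.of_surjective_continuous hqs hqc
  · intro h1 s hs
    obtain ⟨i, hi, rfl⟩ := Esurj s
    rw [← dd_jP (E i) i0, ← dd_jM (E i) i0] at hs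
    have := hPM i hi hs
    rw [h1] at this
    norm_num at this

theorem JJ_strictMono (f : JJ → ℝ) (hc : Continuous f) (hi : Function.Injective f) (hP : f jP = 1)
    (hM : f jM = -1) : StrictMono f := by
  have : Fact ((-1:ℝ) ≤ 1) := ⟨by norm_num⟩
  refine Continuous.strictMono_of_inj_boundedOrder hc ?_ hi
  have h1 : (⊥ : JJ) = jM := rfl
  have h2 : (⊤ : JJ) = jP := rfl
  rw [h1, h2, hP, hM]; norm_num

theorem tau_tau {r : ℕ} (e : Fin r × Bool) : tau (tau e) = e := by simp [tau]
theorem tau_ne {r : ℕ} (e : Fin r × Bool) : tau e ≠ e := by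
  intro h
  have := congrArg Prod.snd h
  simp [tau] at this
theorem fst_eq_cases {r : ℕ} (e e' : Fin r × Bool) (h : e.1 = e'.1) : e = e' ∨ e = tau e' := by
  rcases e with ⟨s, b⟩
  rcases e' with ⟨s', b'⟩
  simp only at h
  subst h
  cases b <;> cases b' <;> simp [tau]

/-- Dichotomy for glueings of bigons: a connected space `Y` obtained from `r ≥ 1` copies
of the closed disc (bigons with vertices `p₊, p₋` and two boundary arcs) by glueing the
`2r` arcs in pairs via homeomorphisms carrying `{p₊,p₋}` onto `{p₊,p₋}` is the 2-sphere
if the two vertices of each bigon stay distinct in `Y`, and the projective plane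
otherwise. -/
theorem bigon_glueing_dichotomy (r : ℕ) (hr : 1 ≤ r)
    (π : Fin r × Bool → Fin r × Bool)
    (hπ : ∀ e, π (π e) = e) (hπ' : ∀ e, π e ≠ e)
    (h : ∀ e, ↥(arc (r := r) e) ≃ₜ ↥(arc (π e)))
    (hinv : ∀ (e) (x : ↥(arc (r := r) e)),
      ((h (π e) (h e x) : ↥(arc (π (π e)))) : DiscUnion r) = (x : DiscUnion r))
    (hmarked : ∀ (e) (x : ↥(arc (r := r) e)),
      ((x : DiscUnion r).2 : EuclideanSpace ℝ (Fin 2)) ∈ ({pP, pM} : Set (EuclideanSpace ℝ (Fin 2))) →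
      (((h e x : ↥(arc (π e))) : DiscUnion r).2 : EuclideanSpace ℝ (Fin 2)) ∈
        ({pP, pM} : Set (EuclideanSpace ℝ (Fin 2))))
    (hconn : ConnectedSpace (Quot (bigonRel π h))) :
    ((∀ s : Fin r,
        Quot.mk (bigonRel π h) ⟨s, ⟨pP, pP_mem⟩⟩ ≠ Quot.mk (bigonRel π h) ⟨s, ⟨pM, pM_mem⟩⟩) →
      Nonempty (Quot (bigonRel π h) ≃ₜ ↥(Metric.sphere (0 : EuclideanSpace ℝ (Fin 3)) 1))) ∧
    ((¬ ∀ s : Fin r,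
        Quot.mk (bigonRel π h) ⟨s, ⟨pP, pP_mem⟩⟩ ≠ Quot.mk (bigonRel π h) ⟨s, ⟨pM, pM_mem⟩⟩) →
      Nonempty (Quot (bigonRel π h) ≃ₜ ProjPlane)) := by
  obtain ⟨Hh, hHh⟩ : ∃ Hh : Fin r × Bool → JJ → JJ, ∀ e t, (Hh e t : ℝ) =
      ht ((h e ⟨dd e i0 t, dd_mem_arc e t⟩ : ↥(arc (π e))) : DiscUnion r) :=
    ⟨fun e t => ⟨_, ht_mem ((h e ⟨dd e i0 t, dd_mem_arc e t⟩ : ↥(arc (π e))) : DiscUnion r)⟩, fun _ _ => rfl⟩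
  have hHd : ∀ e t, ((h e ⟨dd e i0 t, dd_mem_arc e t⟩ : ↥(arc (π e))) : DiscUnion r) = dd (π e) i0 (Hh e t) := by
    intro e t
    have h1 := arc_surj (π e) _ (h e ⟨dd e i0 t, dd_mem_arc e t⟩).2
    rw [h1]
    congr 1
    exact Subtype.ext (hHh e t).symm
  have hHinv : ∀ e t, Hh (π e) (Hh e t) = t := by
    intro e t
    have h1 := hinv e ⟨dd e i0 t, dd_mem_arc e t⟩
    have h2 : h e ⟨dd e i0 t, dd_mem_arc e t⟩ = ⟨dd (π e) i0 (Hh e t), dd_mem_arc _ _⟩ :=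
      Subtype.ext (hHd e t)
    rw [h2] at h1
    apply Subtype.ext
    rw [hHh, h1, ht_dd]
  have hHinj : ∀ e, Function.Injective (Hh e) := fun e =>
    Function.LeftInverse.injective (g := Hh (π e)) (hHinv e)
  have hHc : ∀ e, Continuous (Hh e) := by
    intro e
    rw [continuous_induced_rng]
    have h0 : (Subtype.val ∘ Hh e) = fun t => ht ((h e ⟨dd e i0 t, dd_mem_arc e t⟩ : ↥(arc (π e))) : DiscUnion r) :=
      funext fun t => hHh e t
    rw [h0]
    refine ht_continuous.comp (continuous_subtype_val.comp ((h e).continuous.comp (Continuous.subtype_mk ?_ _)))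
    exact (dd_continuous e).comp (continuous_const.prodMk continuous_id)
  have hHm : ∀ e (t : JJ), (t:ℝ)^2 = 1 → (Hh e t : ℝ)^2 = 1 := by
    intro e t ht1
    have h1 := hmarked e ⟨dd e i0 t, dd_mem_arc e t⟩ (by
      rcases jj_pole t ht1 with h | h
      · subst h; left; exact congrArg (fun p : DiscUnion r => (p.2 : EuclideanSpace ℝ (Fin 2))) (dd_jP e i0)
      · subst h; right; exact congrArg (fun p : DiscUnion r => (p.2 : EuclideanSpace ℝ (Fin 2))) (dd_jM e i0))
    rw [hHh]
    rcases h1 with h1 | h1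
    · rw [ht, h1]; simp [pP]
    · have h1 : _ = pM := h1
      rw [ht, h1]; simp [pM]
  -- the cyclic order
  let e0 : Fin r × Bool := (⟨0, hr⟩, false)
  let ρ : Fin r × Bool → Fin r × Bool := fun e => π (tau e)
  have hρ : Function.Injective ρ := by
    intro x y hxy
    have h1 : π (π (tau x)) = π (π (tau y)) := congrArg π hxy
    rw [hπ, hπ] at h1
    rw [← tau_tau x, h1, tau_tau]
  obtain ⟨n, hn0⟩ : ∃ n, n = Function.minimalPeriod ρ e0 := ⟨_, rfl⟩
  have hn : 0 < n := by
    rw [hn0]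
    exact Function.minimalPeriod_pos_of_mem_periodicPts (hρ.mem_periodicPts e0)
  obtain ⟨E, hE⟩ : ∃ E : ℕ → Fin r × Bool, ∀ i, E i = ρ^[i] e0 := ⟨fun i => ρ^[i] e0, fun _ => rfl⟩
  have hES : ∀ i, E (i+1) = π (tau (E i)) := by
    intro i
    rw [hE, hE, Function.iterate_succ_apply']
  have Eper : E n = E 0 := by
    rw [hE, hE, hn0, Function.iterate_minimalPeriod]; rfl
  have hEtau : ∀ d i, E (i + d) ≠ tau (E i) := by
    intro d
    induction d using Nat.twoStepInduction with
    | zero => intro i hh; exact tau_ne _ hh.symm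
    | one => intro i hh; rw [hES] at hh; exact hπ' _ hh
    | more d ih _ =>
      intro i hh
      apply ih (i+1)
      have h1 : E (i + (d + 2)) = π (tau (E (i + 1 + d))) := by
        rw [← hES]; congr 1; omega
      rw [h1] at hh
      have h2 := congrArg π hh
      rw [hπ, ← hES] at h2
      rw [← h2, tau_tau]
  have Einj : ∀ i < n, ∀ j < n, (E i).1 = (E j).1 → i = j := by
    intro i hi j hj hij
    rcases fst_eq_cases _ _ hij with h1 | h1
    · rw [hE, hE] at h1
      exact Function.iterate_injOn_Iio_minimalPeriod (f := ρ) (x := e0) (by rw [← hn0]; exact hi) (by rw [← hn0]; exact hj) h1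
    · exfalso
      rcases le_total i j with hle | hle
      · obtain ⟨d, rfl⟩ := Nat.exists_eq_add_of_le hle
        exact hEtau d i (by rw [h1, tau_tau])
      · obtain ⟨d, rfl⟩ := Nat.exists_eq_add_of_le hle
        exact hEtau d j h1
  have hpred : ∀ i < n, ∃ k < n, E i = E (k+1) := by
    intro i hi
    cases i with
    | zero => exact ⟨n - 1, by omega, by rw [← Eper]; congr 1; omega⟩
    | succ k => exact ⟨k, by omega, rfl⟩
  let S : Set (Fin r) := {s | ∃ i < n, (E i).1 = s}
  have hSclosed : ∀ e, e.1 ∈ S → (π e).1 ∈ S := by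
    rintro e ⟨i, hi, h1⟩
    rcases fst_eq_cases _ _ h1.symm with h2 | h2
    · obtain ⟨k, hk, h3⟩ := hpred i hi
      refine ⟨k, hk, ?_⟩
      rw [h2, h3, hES, hπ]; rfl
    · rw [h2, ← hES]
      by_cases hi' : i + 1 < n
      · exact ⟨i+1, hi', rfl⟩
      · refine ⟨0, hn, ?_⟩
        rw [← Eper]; congr 2; omega
  have hSiff : ∀ e, e.1 ∈ S ↔ (π e).1 ∈ S := fun e =>
    ⟨hSclosed e, fun hh => by have := hSclosed _ hh; rwa [hπ] at this⟩
  have Esurj : ∀ s, ∃ i < n, (E i).1 = s := by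
    intro s
    let f : Quot (bigonRel π h) → Bool := Quot.lift (fun p => decide (p.1 ∈ S)) (by
      rintro p q ⟨e, hp, hq⟩
      have h1 : p.1 = e.1 := hp.1
      have h2 : q.1 = (π e).1 := by rw [← hq]; exact (h e ⟨p, hp⟩).2.1
      simp only [h1, h2, hSiff e])
    have hf : Continuous f := by
      refine continuous_quot_lift _ ?_
      refine continuous_sigma fun s' => ?_
      change Continuous fun _ : ↥Disc => decide (s' ∈ S)
      exact continuous_const
    have h1 := PreconnectedSpace.constant (inferInstance : PreconnectedSpace (Quot (bigonRel π h))) hf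
      (x := Quot.mk _ ⟨s, ⟨pP, pP_mem⟩⟩) (y := Quot.mk _ ⟨(E 0).1, ⟨pP, pP_mem⟩⟩)
    have h2 : decide (s ∈ S) = decide ((E 0).1 ∈ S) := h1
    have h3 : (E 0).1 ∈ S := ⟨0, hn, rfl⟩
    rw [decide_eq_true h3] at h2
    exact of_decide_eq_true h2
  -- the signs
  obtain ⟨H, hH⟩ : ∃ H : ℕ → JJ → JJ, ∀ i, H i = Hh (tau (E i)) := ⟨fun i => Hh (tau (E i)), fun _ => rfl⟩
  obtain ⟨σ, hσ0, hσS⟩ : ∃ σ : ℕ → ℝ, σ 0 = 1 ∧ ∀ i, σ (i+1) = σ i * H i jP :=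
    ⟨fun i => Nat.rec 1 (fun i x => x * H i jP) i, rfl, fun _ => rfl⟩
  have hHP2 : ∀ i, (H i jP : ℝ)^2 = 1 := fun i => by rw [hH]; exact hHm _ _ (by simp [jP])
  have hHM2 : ∀ i, (H i jM : ℝ)^2 = 1 := fun i => by rw [hH]; exact hHm _ _ (by simp [jM])
  have hσ : ∀ i, σ i * σ i = 1 := by
    intro i
    induction i with
    | zero => rw [hσ0, one_mul]
    | succ i ih => rw [hσS]; linear_combination ((H i jP : ℝ)^2) * ih + hHP2 i
  have hσσ : ∀ i, σ i * σ (i+1) = H i jP := fun i => by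
    rw [hσS]; linear_combination (H i jP : ℝ) * hσ i
  have hHP : ∀ i, σ i * σ (i+1) * (H i jP : ℝ) = 1 := fun i => by
    rw [hσσ]; linarith [hHP2 i]
  have hPM : jP ≠ jM := by
    intro hh
    have := congrArg Subtype.val hh
    norm_num [jP, jM] at this
  have hHM : ∀ i, σ i * σ (i+1) * (H i jM : ℝ) = -1 := fun i => by
    have hne : (H i jP : ℝ) ≠ H i jM := by
      intro hh
      have h1 := Subtype.ext hh
      rw [hH] at h1
      exact hPM (hHinj _ h1)
    rw [hσσ]
    rcases sq_one_cases (hHP2 i) with h1 | h1 <;> rcases sq_one_cases (hHM2 i) with h2 | h2 <;>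
      rw [h1, h2] at hne ⊢ <;> first | exact absurd rfl hne | norm_num
  have Hc : ∀ i, Continuous (H i) := fun i => by rw [hH]; exact hHc _
  have hmono : ∀ i, StrictMono (fun t => σ i * σ (i+1) * (H i t : ℝ)) := by
    intro i
    have := Hc i
    refine JJ_strictMono _ (by fun_prop) ?_ (hHP i) (hHM i)
    intro s t hst
    have h1 : σ i * σ (i+1) ≠ 0 := by
      intro h0
      have := hHP i
      rw [h0] at this
      norm_num at this
    have h2 := Subtype.ext (mul_left_cancel₀ h1 hst)
    rw [hH] at h2
    exact hHinj _ h2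
  let P : DiscUnion r → Quot (bigonRel π h) := Quot.mk _
  have hP : Topology.IsQuotientMap P := isQuotientMap_quot_mk
  have Prel : ∀ i t, P (dd (E i) i1 t) = P (dd (E (i+1)) i0 (H i t)) := by
    intro i t
    apply Quot.sound
    rw [← dd_tau]
    refine ⟨tau (E i), dd_mem_arc _ _, ?_⟩
    rw [hHd, hES, hH]
  have Plift : ∀ {Z : Type} (g : DiscUnion r → Z),
      (∀ i < n, ∀ t, g (dd (E i) i1 t) = g (dd (E (i+1)) i0 (H i t))) → ∀ x y, P x = P y → g x = g y := by
    intro Z g hg x y hxy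
    have hgr : ∀ p q, bigonRel π h p q → g p = g q := by
      rintro p q ⟨e, hp, hq⟩
      obtain ⟨t, rfl⟩ : ∃ t, p = dd e i0 t := ⟨_, arc_surj e p hp⟩
      rw [hHd] at hq
      subst hq
      obtain ⟨i, hi, h1⟩ := Esurj e.1
      rcases fst_eq_cases _ _ h1.symm with h2 | h2
      · obtain ⟨k, hk, h3⟩ := hpred i hi
        have h4 : π e = tau (E k) := by rw [h2, h3, hES, hπ]
        have h5 := hg k hk (Hh e t)
        rw [← dd_tau, hH, ← h4, hHinv, ← h3, ← h2] at h5
        exact h5.symm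
      · have h5 := hg i hi t
        rw [← dd_tau, hES, hH, ← h2] at h5
        exact h5
    exact congrArg (Quot.lift g hgr) hxy
  have hfin1 : σ n = 1 → Nonempty (Quot (bigonRel π h) ≃ₜ S2) ∧
      ∀ s, P ⟨s, ⟨pP, pP_mem⟩⟩ ≠ P ⟨s, ⟨pM, pM_mem⟩⟩ := by
    intro h1
    have := glue_core hn E H σ P hP hσ0 hσ Hc hmono hHP hHM Eper Einj Esurj Prel Plift
      (sph (2 * Real.pi)) (sph_continuous _) sph_full (by rw [h1]; exact sph_ker)
    exact ⟨this.1, this.2.2 h1⟩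
  have hfin2 : σ n = -1 → Nonempty (Quot (bigonRel π h) ≃ₜ ProjPlane) ∧
      P ⟨(E 0).1, ⟨pP, pP_mem⟩⟩ = P ⟨(E 0).1, ⟨pM, pM_mem⟩⟩ := by
    intro h1
    have := glue_core hn E H σ P hP hσ0 hσ Hc hmono hHP hHM Eper Einj Esurj Prel Plift
      (fun a z => pmk (sph Real.pi a z)) (continuous_quot_mk.comp (sph_continuous _)) proj_surj
      (by rw [h1]; exact proj_ker)
    refine ⟨this.1, ?_⟩
    have h2 := this.2.1.2 h1
    rwa [dd_jP, dd_jM] at h2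
  rcases sq_one_cases (show (σ n)^2 = 1 by rw [pow_two]; exact hσ n) with h1 | h1
  · exact ⟨fun _ => (hfin1 h1).1, fun hh => absurd (hfin1 h1).2 hh⟩
  · exact ⟨fun hh => absurd (hfin2 h1).2 (hh _), fun _ => (hfin2 h1).1⟩
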